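/- arXiv:2212.14208 — 5 statements merged into one kernel-verified Lean document; each statement's English description precedes it below -/
import Mathlib

section
/- Let A = H + S with H ∈ ℂ^{n×n} Hermitian positive definite and S skew-Hermitian, let b, x_0 ∈ ℂ^n, and suppose every eigenvalue of H^{-1}S lies in i[α, β] for real numbers α < β (i.e. each eigenvalue equals iμ with μ ∈ [α, β]). Let R > 1 be the unique solution of (1/2)(R + 1/R) = (√(β²+1) + √(α²+1))/(β − α). Set K_m = span{(H^{-1}A)^j (H^{-1}(b − A x_0)) : 0 ≤ j < m}. Then there exists x ∈ x_0 + K_m with ‖b − Ax‖_{H^{-1}} ≤ (2/(R^m + R^{-m})) · ‖b − A x_0‖_{H^{-1}}; in particular the minimal residual (ℓMR) iterate x_m, which minimizes ‖b − Ax‖_{H^{-1}} over x ∈ x_0 + K_m, satisfies this bound. -/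
open Matrix
open scoped ComplexOrder

/-- The `H⁻¹`-norm of the residual `b - A x`. -/
noncomputable def resNormHinv {n : ℕ} (H A : Matrix (Fin n) (Fin n) ℂ)
    (b x : Fin n → ℂ) : ℝ :=
  Real.sqrt ((star (b - A *ᵥ x) ⬝ᵥ H⁻¹ *ᵥ (b - A *ᵥ x)).re)

section Chebyshev

open Polynomial

/-- If `z` lies on the ellipse with foci `±1` and semi-axis sum `R`, then some constant shift of
the Chebyshev polynomial `T_m` by `t * I` grows at `z` at least like the value of `T_m` at the real
vertex of the ellipse. -/
lemma exists_sq_le_normSq_chebyshev_add (z : ℂ) (R : ℝ) (hR : 1 < R)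
    (hz : ‖z - 1‖ + ‖z + 1‖ = R + 1 / R) (m : ℕ) :
    ∃ t : ℝ, ((R ^ m + R⁻¹ ^ m) / 2) ^ 2 * (1 + t ^ 2) ≤
      Complex.normSq ((Chebyshev.T ℂ m).eval z + t * Complex.I) := by
  obtain ⟨w, rfl⟩ := Complex.cos_surjective z
  have norm_add (e : ℝ) (he : e ^ 2 = 1) (hpos : 0 ≤ Real.cosh w.im + e * Real.cos w.re) :
      ‖Complex.cos w + e‖ = Real.cosh w.im + e * Real.cos w.re := by
    rw [Complex.norm_def, ← Real.sqrt_sq hpos]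
    congr 1
    rw [Complex.cos_eq, ← Complex.ofReal_cos, ← Complex.ofReal_sin, ← Complex.ofReal_cosh,
      ← Complex.ofReal_sinh, Complex.normSq_apply]
    simp only [Complex.add_re, Complex.sub_re, Complex.mul_re, Complex.ofReal_re,
      Complex.ofReal_im, Complex.I_re, Complex.I_im, Complex.add_im, Complex.sub_im,
      Complex.mul_im]
    have h1 := Real.sin_sq_add_cos_sq w.re
    have h2 := Real.cosh_sq w.im
    ring_nf
    linear_combination (Real.sinh w.im ^ 2) * h1 + (Real.cos w.re ^ 2 - 1) * h2 +
      (1 - Real.cos w.re ^ 2) * he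
  have hc1 := Real.one_le_cosh w.im
  have hcos : Real.cosh w.im = (R + R⁻¹) / 2 := by
    have h1 := norm_add 1 (by norm_num) (by linarith [Real.neg_one_le_cos w.re])
    have h2 := norm_add (-1) (by norm_num) (by linarith [Real.cos_le_one w.re])
    simp only [Complex.ofReal_one, Complex.ofReal_neg, ← sub_eq_add_neg] at h1 h2
    rw [h1, h2, one_div] at hz
    linarith
  have hR0 : 0 < R := by linarith
  have habs : |w.im| = Real.log R := by
    have : Real.cosh |w.im| = Real.cosh (Real.log R) := by
      rw [Real.cosh_abs, hcos, Real.cosh_log hR0]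
    exact Real.cosh_strictMonoOn.injOn (abs_nonneg w.im) (Real.log_pos hR).le this
  have hcoshm : Real.cosh (m * w.im) = (R ^ m + R⁻¹ ^ m) / 2 := by
    rw [← Real.cosh_abs, abs_mul, habs, Nat.abs_cast, ← Real.log_pow,
      Real.cosh_log (by positivity), inv_pow]
  have hT : (Chebyshev.T ℂ m).eval (Complex.cos w) = Complex.cos (m * w) :=
    mod_cast Chebyshev.T_complex_cos w m
  rw [hT, ← hcoshm]
  have hre : ((m : ℂ) * w).re = m * w.re := by simp
  have him : ((m : ℂ) * w).im = m * w.im := by simp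
  have key (t : ℝ) : Complex.normSq (Complex.cos (m * w) + t * Complex.I) =
      (Real.cos (m * w.re) * Real.cosh (m * w.im)) ^ 2 +
        (t - Real.sin (m * w.re) * Real.sinh (m * w.im)) ^ 2 := by
    rw [Complex.cos_eq, hre, him, ← Complex.ofReal_cos, ← Complex.ofReal_sin,
      ← Complex.ofReal_cosh, ← Complex.ofReal_sinh, Complex.normSq_apply]
    simp only [Complex.add_re, Complex.sub_re, Complex.mul_re, Complex.ofReal_re,
      Complex.ofReal_im, Complex.I_re, Complex.I_im, Complex.add_im, Complex.sub_im,
      Complex.mul_im]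
    ring
  have h1 := Real.sin_sq_add_cos_sq (m * w.re)
  have h2 := Real.cosh_sq (m * w.im)
  rcases Nat.eq_zero_or_pos m with rfl | hm
  · exact ⟨0, by simp⟩
  have hsinh : Real.sinh (m * w.im) ≠ 0 := by
    rw [Ne, Real.sinh_eq_zero]
    have : w.im ≠ 0 := by
      intro h
      rw [h, abs_zero] at habs
      linarith [Real.log_pos hR]
    positivity
  refine ⟨-Real.sin (m * w.re) / Real.sinh (m * w.im), le_of_eq ?_⟩
  rw [key]
  field_simp
  generalize Real.cosh (m * w.im) = a at *
  generalize Real.sinh (m * w.im) = s at *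
  have h3 : Real.cos (m * w.re) ^ 2 = 1 - Real.sin (m * w.re) ^ 2 := by linarith
  generalize Real.cos (m * w.re) = c at *
  generalize Real.sin (m * w.re) = d at *
  simp only [h3, h2]
  ring

lemma eval_chebyshev_T_sq_le_one {s : ℝ} (h₁ : -1 ≤ s) (h₂ : s ≤ 1) (m : ℕ) :
    (Chebyshev.T ℝ m).eval s ^ 2 ≤ 1 := by
  rw [← Real.cos_arccos h₁ h₂, Chebyshev.T_real_cos]
  exact Real.cos_sq_le_one _

/-- A polynomial normalised at `0` which is small on the segment from `1 + α i` to `1 + β i`. -/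
lemma exists_polynomial_eval_zero_eq_one_norm_le {α β R : ℝ} (hαβ : α < β) (hR : 1 < R)
    (hReq : (1 / 2) * (R + 1 / R) = (√(β ^ 2 + 1) + √(α ^ 2 + 1)) / (β - α)) (m : ℕ) :
    ∃ p : ℂ[X], p.natDegree ≤ m ∧ p.eval 0 = 1 ∧ ∀ μ : ℝ, α ≤ μ → μ ≤ β →
      ‖p.eval (1 + μ * Complex.I)‖ ≤ 2 / (R ^ m + R⁻¹ ^ m) := by
  have hd : 0 < β - α := sub_pos.2 hαβ
  have hdC : (β : ℂ) - α ≠ 0 := by exact_mod_cast hd.ne'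
  set z : ℂ := (2 * Complex.I - α - β) / (β - α) with hz
  have hnorm (γ : ℝ) : ‖(2 * (Complex.I - γ)) / ((β : ℂ) - α)‖ = 2 * √(γ ^ 2 + 1) / (β - α) := by
    rw [norm_div, norm_mul, ← Complex.ofReal_sub, Complex.norm_real, Real.norm_of_nonneg hd.le,
      Complex.norm_def (Complex.I - γ), Complex.normSq_apply]
    simp [sq]
  obtain ⟨t, ht⟩ := exists_sq_le_normSq_chebyshev_add z R hR (by
    have e1 : z - 1 = (2 * (Complex.I - β)) / (β - α) := by rw [hz]; field_simp; ring
    have e2 : z + 1 = (2 * (Complex.I - α)) / (β - α) := by rw [hz]; field_simp; ring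
    rw [e1, e2, hnorm, hnorm]
    linear_combination (-2) * hReq) m
  set v : ℂ := (Chebyshev.T ℂ m).eval z + t * Complex.I
  set a : ℝ := (R ^ m + R⁻¹ ^ m) / 2
  have ha : 0 < a := by positivity
  have ht1 : 0 < 1 + t ^ 2 := by positivity
  have hv : v ≠ 0 := by
    rw [← Complex.normSq_pos]
    exact lt_of_lt_of_le (by positivity) ht
  set l : ℂ[X] := C (-2 * Complex.I / (β - α)) * X + C z with hl
  have hldeg : l.natDegree ≤ 1 := natDegree_linear_le
  refine ⟨C v⁻¹ * ((Chebyshev.T ℂ m).comp l + C (t * Complex.I)), ?_, ?_, fun μ h₁ h₂ => ?_⟩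
  · refine (natDegree_C_mul_le _ _).trans (natDegree_add_le_of_degree_le ?_
      ((natDegree_C _).trans_le m.zero_le))
    refine natDegree_comp_le.trans ?_
    rw [Chebyshev.natDegree_T]
    simpa using Nat.mul_le_mul_left m hldeg
  · simp only [eval_mul, eval_C, eval_add, eval_comp, hl, eval_X, mul_zero, zero_add]
    exact inv_mul_cancel₀ hv
  · have hs : l.eval (1 + μ * Complex.I) = ((2 * μ - α - β) / (β - α) : ℝ) := by
      simp only [hl, hz, eval_add, eval_mul, eval_C, eval_X]
      push_cast
      field_simp
      linear_combination (-2 * (μ : ℂ)) * Complex.I_sq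
    have hT := eval_chebyshev_T_sq_le_one (s := (2 * μ - α - β) / (β - α))
      (by rw [le_div_iff₀ hd]; linarith) (by rw [div_le_iff₀ hd]; linarith) m
    simp only [eval_mul, eval_C, eval_add, eval_comp, hs, ← Chebyshev.complex_ofReal_eval_T]
    generalize (Chebyshev.T ℝ m).eval ((2 * μ - α - β) / (β - α)) = y at hT
    have e : 2 / (R ^ m + R⁻¹ ^ m) = 1 / a := by simp only [a, one_div_div]
    rw [e, norm_mul, norm_inv, inv_mul_eq_div, div_le_div_iff₀ (norm_pos_iff.2 hv) ha, one_mul]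
    refine le_of_sq_le_sq ?_ (norm_nonneg _)
    rw [mul_pow, Complex.sq_norm, Complex.sq_norm, Complex.normSq_add_mul_I]
    nlinarith [sq_nonneg a]

end Chebyshev

section Diagonalization

open scoped MatrixOrder Matrix.Norms.L2Operator in
lemma Matrix.PosDef.exists_isUnit_eq_conjTranspose_mul_self {ι : Type*} [Fintype ι] [DecidableEq ι]
    {H : Matrix ι ι ℂ} (hH : H.PosDef) : ∃ B : Matrix ι ι ℂ, IsUnit B ∧ H = Bᴴ * B :=
  CStarAlgebra.isStrictlyPositive_iff_eq_star_mul_self.mp hH.isStrictlyPositive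

/-- For `H` positive definite and `S` skew-Hermitian, `H⁻¹ S` is unitarily diagonalizable with
respect to the inner product defined by `H`. -/
lemma Matrix.PosDef.exists_diagonalization_inv_mul {ι : Type*} [Fintype ι] [DecidableEq ι]
    {H S : Matrix ι ι ℂ} (hH : H.PosDef) (hS : Sᴴ = -S) :
    ∃ (V : Matrix ι ι ℂ) (d : ι → ℝ), IsUnit V ∧ H = Vᴴ * V ∧
      V * (H⁻¹ * S) = diagonal (fun i => (d i : ℂ) * Complex.I) * V := by
  obtain ⟨B, hB, rfl⟩ := hH.exists_isUnit_eq_conjTranspose_mul_self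
  have hBdet : IsUnit B.det := (Matrix.isUnit_iff_isUnit_det B).1 hB
  set T : Matrix ι ι ℂ := (-Complex.I) • ((B⁻¹)ᴴ * S * B⁻¹) with hT
  have hTH : T.IsHermitian := by
    simp [Matrix.IsHermitian, hT, conjTranspose_smul, conjTranspose_mul, hS, Matrix.mul_assoc]
  set U : Matrix ι ι ℂ := (hTH.eigenvectorUnitary : Matrix ι ι ℂ) with hU
  have hU1 : U * Uᴴ = 1 := Unitary.coe_mul_star_self hTH.eigenvectorUnitary
  have hU2 : Uᴴ * U = 1 := Unitary.coe_star_mul_self hTH.eigenvectorUnitary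
  have hspec : T = U * diagonal (fun i => (hTH.eigenvalues i : ℂ)) * Uᴴ := by
    have := hTH.spectral_theorem
    rw [Unitary.conjStarAlgAut_apply] at this
    exact this
  have hUT : Uᴴ * T = diagonal (fun i => (hTH.eigenvalues i : ℂ)) * Uᴴ := by
    refine (congrArg (Uᴴ * ·) hspec).trans ?_
    simp only [← Matrix.mul_assoc, hU2, Matrix.one_mul]
  have hBS : (B⁻¹)ᴴ * S = Complex.I • (T * B) := by
    rw [hT, Matrix.smul_mul, smul_smul, Matrix.mul_assoc _ B⁻¹ B, Matrix.nonsing_inv_mul _ hBdet]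
    simp
  refine ⟨Uᴴ * B, hTH.eigenvalues, (IsUnit.of_mul_eq_one _ hU2).mul hB, ?_, ?_⟩
  · rw [conjTranspose_mul, conjTranspose_conjTranspose, Matrix.mul_assoc, ← Matrix.mul_assoc U,
      hU1, Matrix.one_mul]
  · have hD : diagonal (fun i => (hTH.eigenvalues i : ℂ) * Complex.I) =
        Complex.I • diagonal (fun i => (hTH.eigenvalues i : ℂ)) := by
      rw [← diagonal_smul]
      congr 1
      ext i
      simp [mul_comm]
    rw [Matrix.mul_inv_rev, ← conjTranspose_nonsing_inv, Matrix.mul_assoc, Matrix.mul_assoc,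
      hBS, ← Matrix.mul_assoc B, Matrix.mul_nonsing_inv _ hBdet, Matrix.one_mul,
      Matrix.mul_smul, ← Matrix.mul_assoc, hUT, hD, Matrix.smul_mul, Matrix.mul_assoc]

end Diagonalization

section Polynomial

open Polynomial

lemma Matrix.mul_aeval_mulVec_apply_of_mul_eq_diagonal_mul {ι : Type*} [Fintype ι] [DecidableEq ι]
    {V M : Matrix ι ι ℂ} {c : ι → ℂ} (h : V * M = diagonal c * V) (p : ℂ[X]) (y : ι → ℂ) (i : ι) :
    (V *ᵥ (aeval M p *ᵥ y)) i = p.eval (c i) * (V *ᵥ y) i := by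
  have hpow (k : ℕ) : V * M ^ k = diagonal c ^ k * V :=
    (SemiconjBy.pow_right (a := V) (x := M) (y := diagonal c) h k)
  rw [aeval_eq_sum_range, eval_eq_sum_range, sum_mulVec, mulVec_sum, Finset.sum_apply,
    Finset.sum_mul]
  refine Finset.sum_congr rfl fun k _ => ?_
  rw [smul_mulVec, mulVec_smul, mulVec_mulVec, hpow, ← mulVec_mulVec, diagonal_pow,
    Pi.smul_apply, mulVec_diagonal, smul_eq_mul, Pi.pow_apply, mul_assoc]

lemma Matrix.aeval_mulVec_mem_span {ι : Type*} [Fintype ι] [DecidableEq ι]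
    (M : Matrix ι ι ℂ) (y : ι → ℂ) {q : ℂ[X]} {m : ℕ} (hq : q.degree < m) :
    aeval M q *ᵥ y ∈ Submodule.span ℂ {w : ι → ℂ | ∃ j < m, w = (M ^ j) *ᵥ y} := by
  rw [aeval_eq_sum_range, sum_mulVec]
  refine Submodule.sum_mem _ fun k hk => ?_
  rw [smul_mulVec]
  by_cases hkm : k < m
  · exact Submodule.smul_mem _ _ (Submodule.subset_span ⟨k, hkm, rfl⟩)
  · rw [coeff_eq_zero_of_degree_lt (hq.trans_le (by exact_mod_cast not_lt.1 hkm)), zero_smul]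
    exact Submodule.zero_mem _

end Polynomial

lemma resNormHinv_eq_sqrt_sum {n : ℕ} {H V A : Matrix (Fin n) (Fin n) ℂ} (hH : H = Vᴴ * V)
    (hV : IsUnit V) {b x y : Fin n → ℂ} (hy : b - A *ᵥ x = H *ᵥ y) :
    resNormHinv H A b x = √(∑ i, ‖(V *ᵥ y) i‖ ^ 2) := by
  have hHdet : IsUnit H.det := by
    rw [← Matrix.isUnit_iff_isUnit_det, hH]
    exact hV.star.mul hV
  unfold resNormHinv
  rw [hy, mulVec_mulVec, Matrix.nonsing_inv_mul _ hHdet, one_mulVec]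
  congr 1
  rw [hH, ← mulVec_mulVec, star_mulVec, conjTranspose_conjTranspose, ← dotProduct_mulVec,
    dotProduct, Complex.re_sum]
  refine Finset.sum_congr rfl fun i _ => ?_
  rw [Complex.sq_norm, Complex.normSq_apply]
  simp [Complex.mul_re]

/-- Freund-type residual bound for the ℓMR method: if `A = H + S` with `H` Hermitian positive
definite, `S` skew-Hermitian, every eigenvalue of `H⁻¹S` lies in `i[α,β]` with `α < β`, and
`R > 1` solves `(1/2)(R + 1/R) = (√(β²+1) + √(α²+1))/(β-α)`, then there is `x ∈ x₀ + K_m`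
with `‖b - Ax‖_{H⁻¹} ≤ (2/(Rᵐ + R⁻ᵐ)) ‖b - Ax₀‖_{H⁻¹}`; in particular any minimizer of the
residual `H⁻¹`-norm over `x₀ + K_m` satisfies this bound. -/
theorem lmr_freund_residual_bound {n : ℕ} (H S A : Matrix (Fin n) (Fin n) ℂ)
    (hH : H.PosDef) (hS : Sᴴ = -S) (hA : A = H + S)
    (b x0 : Fin n → ℂ) (α β : ℝ) (hαβ : α < β)
    (heig : ∀ μ : ℂ, (∃ v : Fin n → ℂ, v ≠ 0 ∧ (H⁻¹ * S) *ᵥ v = μ • v) →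
      μ.re = 0 ∧ α ≤ μ.im ∧ μ.im ≤ β)
    (R : ℝ) (hR : 1 < R)
    (hReq : (1 / 2) * (R + 1 / R) = (Real.sqrt (β ^ 2 + 1) + Real.sqrt (α ^ 2 + 1)) / (β - α))
    (m : ℕ) (K : Submodule ℂ (Fin n → ℂ))
    (hK : K = Submodule.span ℂ {w : Fin n → ℂ | ∃ j < m,
      w = ((H⁻¹ * A) ^ j) *ᵥ (H⁻¹ *ᵥ (b - A *ᵥ x0))}) :
    (∃ x : Fin n → ℂ, x - x0 ∈ K ∧
      resNormHinv H A b x ≤ (2 / (R ^ m + R⁻¹ ^ m)) * resNormHinv H A b x0) ∧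
    (∀ x : Fin n → ℂ, x - x0 ∈ K →
      (∀ y : Fin n → ℂ, y - x0 ∈ K → resNormHinv H A b x ≤ resNormHinv H A b y) →
      resNormHinv H A b x ≤ (2 / (R ^ m + R⁻¹ ^ m)) * resNormHinv H A b x0) := by
  have hex : ∃ x : Fin n → ℂ, x - x0 ∈ K ∧
      resNormHinv H A b x ≤ (2 / (R ^ m + R⁻¹ ^ m)) * resNormHinv H A b x0 := by
    subst hK
    obtain ⟨V, d, hV, hHV, hVN⟩ := hH.exists_diagonalization_inv_mul hS
    have hHdet : IsUnit H.det := (Matrix.isUnit_iff_isUnit_det H).1 hH.isUnit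
    have hVdet : IsUnit V.det := (Matrix.isUnit_iff_isUnit_det V).1 hV
    have hd (i : Fin n) : α ≤ d i ∧ d i ≤ β := by
      have := heig (d i * Complex.I) ⟨V⁻¹ *ᵥ Pi.single i 1, fun h => ?_, ?_⟩
      · simpa using this.2
      · have h' : V *ᵥ (V⁻¹ *ᵥ Pi.single i 1) = 0 := by rw [h, mulVec_zero]
        rw [mulVec_mulVec, Matrix.mul_nonsing_inv _ hVdet, one_mulVec] at h'
        simpa using congrFun h' i
      · have hinv : H⁻¹ * S = V⁻¹ * (diagonal (fun i => (d i : ℂ) * Complex.I) * V) := by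
          rw [← hVN, ← Matrix.mul_assoc, Matrix.nonsing_inv_mul _ hVdet, Matrix.one_mul]
        rw [hinv, mulVec_mulVec, Matrix.mul_assoc, Matrix.mul_assoc,
          Matrix.mul_nonsing_inv _ hVdet, Matrix.mul_one, ← mulVec_mulVec,
          diagonal_mulVec_single, ← mulVec_smul, ← Pi.single_smul, smul_eq_mul]
    have hHA : H⁻¹ * A = 1 + H⁻¹ * S := by
      rw [hA, Matrix.mul_add, Matrix.nonsing_inv_mul _ hHdet]
    have hVM : V * (H⁻¹ * A) = diagonal (fun i => 1 + (d i : ℂ) * Complex.I) * V := by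
      rw [hHA, Matrix.mul_add, hVN, ← diagonal_add, Matrix.add_mul, diagonal_one,
        Matrix.mul_one, Matrix.one_mul]
    obtain ⟨p, hpdeg, hp0, hp⟩ :=
      exists_polynomial_eval_zero_eq_one_norm_le hαβ hR hReq m
    obtain ⟨y0, hy0⟩ : ∃ y0, y0 = H⁻¹ *ᵥ (b - A *ᵥ x0) := ⟨_, rfl⟩
    have hHy0 : b - A *ᵥ x0 = H *ᵥ y0 := by
      rw [hy0, mulVec_mulVec, Matrix.mul_nonsing_inv _ hHdet, one_mulVec]
    have hpX : Polynomial.aeval (H⁻¹ * A) p = H⁻¹ * A * Polynomial.aeval (H⁻¹ * A) p.divX + 1 := by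
      conv_lhs => rw [← p.X_mul_divX_add, Polynomial.coeff_zero_eq_eval_zero, hp0]
      simp
    have hqdeg : p.divX.degree < m := by
      rw [Polynomial.degree_lt_iff_coeff_zero]
      intro k hk
      rw [Polynomial.coeff_divX]
      exact Polynomial.coeff_eq_zero_of_natDegree_lt (by omega)
    set x : Fin n → ℂ := x0 - Polynomial.aeval (H⁻¹ * A) p.divX *ᵥ y0 with hx
    have hHx : b - A *ᵥ x = H *ᵥ (Polynomial.aeval (H⁻¹ * A) p *ᵥ y0) := by
      rw [hpX, add_mulVec, one_mulVec, mulVec_add, ← hHy0, hx, mulVec_sub, mulVec_mulVec,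
        mulVec_mulVec, ← Matrix.mul_assoc, ← Matrix.mul_assoc, Matrix.mul_nonsing_inv _ hHdet,
        Matrix.one_mul]
      abel
    refine ⟨x, ?_, ?_⟩
    · rw [hx, sub_sub_cancel_left, ← hy0]
      exact Submodule.neg_mem _ (Matrix.aeval_mulVec_mem_span _ _ hqdeg)
    · have hc : 0 ≤ 2 / (R ^ m + R⁻¹ ^ m) := by positivity
      rw [resNormHinv_eq_sqrt_sum hHV hV hHx, resNormHinv_eq_sqrt_sum hHV hV hHy0,
        ← Real.sqrt_sq hc, ← Real.sqrt_mul (sq_nonneg _), Finset.mul_sum]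
      refine Real.sqrt_le_sqrt (Finset.sum_le_sum fun i _ => ?_)
      rw [Matrix.mul_aeval_mulVec_apply_of_mul_eq_diagonal_mul hVM, norm_mul, mul_pow]
      gcongr
      exact hp _ (hd i).1 (hd i).2
  refine ⟨hex, fun x _ hmin => ?_⟩
  obtain ⟨y, hyK, hy⟩ := hex
  exact (hmin y hyK).trans hy
end

section
/- Let α, β, λ be real numbers with α < β, λ > 0, −λ ≤ α and β ≤ λ (i.e. [α,β] ⊆ [−λ,λ]). Then (√(β²+1) + √(α²+1))/(β − α) ≥ √(λ²+1)/λ. -/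
/-- `x ↦ √(x² + 1) / |x|` is antitone in `|x|`, stated without division. -/
theorem abs_mul_sqrt_sq_add_one_le {x y : ℝ} (h : |x| ≤ y) :
    |x| * Real.sqrt (y ^ 2 + 1) ≤ Real.sqrt (x ^ 2 + 1) * y := by
  have hy : 0 ≤ y := (abs_nonneg x).trans h
  have hxy : x ^ 2 ≤ y ^ 2 := sq_le_sq' (abs_le.mp h).1 (abs_le.mp h).2
  refine abs_le_of_sq_le_sq' ?_ (by positivity) |>.2
  rw [mul_pow, mul_pow, Real.sq_sqrt (by positivity), Real.sq_sqrt (by positivity), sq_abs]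
  linarith

/-- If `[α, β] ⊆ [-λ, λ]` with `α < β` and `λ > 0`, then
`(√(β²+1) + √(α²+1))/(β - α) ≥ √(λ²+1)/λ`. -/
theorem freund_parameter_monotonicity (α β lam : ℝ) (hαβ : α < β) (hlam : 0 < lam)
    (hα : -lam ≤ α) (hβ : β ≤ lam) :
    Real.sqrt (lam ^ 2 + 1) / lam ≤
      (Real.sqrt (β ^ 2 + 1) + Real.sqrt (α ^ 2 + 1)) / (β - α) := by
  have h₁ := abs_mul_sqrt_sq_add_one_le (abs_le.mpr ⟨hα, hαβ.le.trans hβ⟩)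
  have h₂ := abs_mul_sqrt_sq_add_one_le (abs_le.mpr ⟨hα.trans hαβ.le, hβ⟩)
  have h₃ : β - α ≤ |β| + |α| := by linarith [le_abs_self β, neg_le_abs α]
  rw [div_le_div_iff₀ hlam (sub_pos.mpr hαβ)]
  linarith [mul_le_mul_of_nonneg_left h₃ (Real.sqrt_nonneg (lam ^ 2 + 1))]
end

section
/- Let α, β, λ be real with α < β, λ > 0, λ ≥ β and λ ≥ −α. Let R > 1 be the unique solution of (1/2)(R + 1/R) = (√(β²+1) + √(α²+1))/(β − α). Then for every positive integer m, 2/(R^m + R^{-m}) ≤ 2 (λ/(√(1+λ²) + 1))^m. That is, the Freund-type residual bound 2/(R^m + R^{-m}) is always at least as small as the classical bound 2 (λ/(√(1+λ²)+1))^m. -/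
/-- On `[-l, l]` the function `x / √(x² + 1)` is at most its value at `l`. -/
lemma mul_sqrt_one_add_sq_le {x l : ℝ} (hl : 0 < l) (hx : |x| ≤ l) :
    x * Real.sqrt (1 + l ^ 2) ≤ l * Real.sqrt (x ^ 2 + 1) := by
  have h1 : 0 ≤ 1 + l ^ 2 := by positivity
  have h2 : 0 ≤ x ^ 2 + 1 := by positivity
  have h3 : x ^ 2 ≤ l ^ 2 := sq_le_sq' (abs_le.mp hx).1 (abs_le.mp hx).2
  refine abs_le_of_sq_le_sq' ?_ (by positivity) |>.2
  rw [mul_pow, mul_pow, Real.sq_sqrt h1, Real.sq_sqrt h2]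
  linarith

/-- If `R > 1` and `(R + R⁻¹) / 2` is at least `√(1 + l²) / l`, then `R` is at least the root
`(√(1 + l²) + 1) / l` of the corresponding equation. -/
lemma sqrt_add_one_le_mul {l R : ℝ} (hl : 0 < l) (hR : 1 < R)
    (h : 2 * Real.sqrt (1 + l ^ 2) * R ≤ l * (R ^ 2 + 1)) :
    Real.sqrt (1 + l ^ 2) + 1 ≤ l * R := by
  have hs : Real.sqrt (1 + l ^ 2) ^ 2 = 1 + l ^ 2 := Real.sq_sqrt (by positivity)
  have hs_lt : Real.sqrt (1 + l ^ 2) < 1 + l := by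
    rw [Real.sqrt_lt' (by positivity)]
    nlinarith
  set s := Real.sqrt (1 + l ^ 2)
  have hpos : 0 < l * R - s + 1 := by nlinarith
  have hprod : 0 ≤ (l * R - s + 1) * (l * R - s - 1) := by
    nlinarith [mul_le_mul_of_nonneg_left h hl.le]
  linarith [nonneg_of_mul_nonneg_right hprod hpos]


/-- The Freund-type residual bound is always at least as small as the classical one:
if `α < β`, `λ > 0`, `λ ≥ β`, `λ ≥ -α`, and `R > 1` solves
`(1/2)(R + 1/R) = (√(β²+1) + √(α²+1))/(β - α)`, then for every positive integer `m`,
`2/(Rᵐ + R⁻ᵐ) ≤ 2 (λ/(√(1+λ²)+1))ᵐ`. -/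
theorem freund_bound_le_classical_bound (α β lam : ℝ) (hαβ : α < β) (hlam : 0 < lam)
    (hβ : β ≤ lam) (hα : -lam ≤ α) (R : ℝ) (hR : 1 < R)
    (hReq : (1 / 2) * (R + 1 / R) = (Real.sqrt (β ^ 2 + 1) + Real.sqrt (α ^ 2 + 1)) / (β - α)) :
    ∀ m : ℕ, 1 ≤ m →
      2 / (R ^ m + R⁻¹ ^ m) ≤ 2 * (lam / (Real.sqrt (1 + lam ^ 2) + 1)) ^ m := by
  intro m _
  have hR0 : 0 < R := by linarith
  have hB := mul_sqrt_one_add_sq_le hlam (x := β) (abs_le.mpr ⟨by linarith, hβ⟩)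
  have hA := mul_sqrt_one_add_sq_le hlam (x := -α) (abs_le.mpr ⟨by linarith, by linarith⟩)
  rw [neg_sq] at hA
  have hq : Real.sqrt (1 + lam ^ 2) / lam ≤ (1 / 2) * (R + 1 / R) := by
    rw [hReq, div_le_div_iff₀ hlam (sub_pos.mpr hαβ)]
    linarith
  have hkey : 2 * Real.sqrt (1 + lam ^ 2) * R ≤ lam * (R ^ 2 + 1) := by
    have hform : (1 / 2) * (R + 1 / R) = (R ^ 2 + 1) / (2 * R) := by
      field_simp
    rw [hform, div_le_div_iff₀ hlam (by positivity)] at hq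
    linarith
  have hinv : R⁻¹ ≤ lam / (Real.sqrt (1 + lam ^ 2) + 1) := by
    rw [inv_eq_one_div, div_le_div_iff₀ hR0 (by positivity), one_mul]
    exact sqrt_add_one_le_mul hlam hR hkey
  calc 2 / (R ^ m + R⁻¹ ^ m) ≤ 2 / R ^ m := by
        gcongr
        exact le_add_of_nonneg_right (by positivity)
    _ = 2 * R⁻¹ ^ m := by rw [inv_pow, div_eq_mul_inv]
    _ ≤ 2 * (lam / (Real.sqrt (1 + lam ^ 2) + 1)) ^ m := by gcongr
end

section
/- Let H ∈ ℂ^{n×n} be Hermitian positive definite, let V ∈ ℂ^{n×k} have linearly independent columns, and let w ∈ ℂ^n with V*w ≠ 0. Then V*HV is invertible, and the quantity ⟨w, V (V*HV)^{-1} V* w⟩ = (V*w)* (V*HV)^{-1} (V*w) is a real, strictly positive number. In particular, when the inexact solve ŵ ≈ H^{-1}w in the flexible Lanczos process is computed by k steps of (preconditioned) CG with initial guess 0, one has β = ⟨w, ŵ⟩ > 0 whenever w ≠ 0, so no unlucky breakdown can occur. -/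
open Matrix
open scoped ComplexOrder

/-- No unlucky breakdown with CG inner solves: if `H` is Hermitian positive definite,
the columns of `V` are linearly independent, and `V* w ≠ 0`, then `V* H V` is invertible
and `⟨w, V (V*HV)⁻¹ V* w⟩ = (V*w)* (V*HV)⁻¹ (V*w)` is a real, strictly positive number. -/
theorem cg_no_unlucky_breakdown {n k : ℕ} (H : Matrix (Fin n) (Fin n) ℂ) (hH : H.PosDef)
    (V : Matrix (Fin n) (Fin k) ℂ) (hV : LinearIndependent ℂ (fun j : Fin k => fun i : Fin n => V i j))
    (w : Fin n → ℂ) (hw : Vᴴ *ᵥ w ≠ 0) :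
    IsUnit (Vᴴ * H * V) ∧
    star (V *ᵥ ((Vᴴ * H * V)⁻¹ *ᵥ (Vᴴ *ᵥ w))) ⬝ᵥ w =
      star (Vᴴ *ᵥ w) ⬝ᵥ ((Vᴴ * H * V)⁻¹ *ᵥ (Vᴴ *ᵥ w)) ∧
    (star (Vᴴ *ᵥ w) ⬝ᵥ ((Vᴴ * H * V)⁻¹ *ᵥ (Vᴴ *ᵥ w))).im = 0 ∧
    0 < (star (Vᴴ *ᵥ w) ⬝ᵥ ((Vᴴ * H * V)⁻¹ *ᵥ (Vᴴ *ᵥ w))).re := by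
  have hinj : Function.Injective V.mulVec := mulVec_injective_iff.mpr hV
  have hM : (Vᴴ * H * V).PosDef := hH.conjTranspose_mul_mul_same hinj
  have hpos := Complex.pos_iff.mp (hM.inv.dotProduct_mulVec_pos hw)
  refine ⟨hM.isUnit, ?_, hpos.2.symm, hpos.1⟩
  rw [star_mulVec, ← dotProduct_mulVec, star_mulVec, hM.inv.isHermitian.eq, ← dotProduct_mulVec]
end

section
/- Let H ∈ ℂ^{n×n} be Hermitian positive definite, 0 ≤ ε < 1, and let v, z ∈ ℂ^n satisfy ⟨v, z⟩ = 1 (standard inner product) and ‖z − H^{-1}v‖_H ≤ ε · ‖H^{-1}v‖_H. Then 1/(1+ε) ≤ ‖v‖²_{H^{-1}} ≤ 1/(1−ε), where ‖v‖²_{H^{-1}} = v*H^{-1}v. -/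
open Matrix
open scoped ComplexOrder

/-- Cauchy–Schwarz inequality for the real part of the form of a positive semidefinite matrix. -/
theorem Matrix.PosSemidef.sq_re_star_dotProduct_mulVec_le {m : Type*} [Fintype m]
    {M : Matrix m m ℂ} (hM : M.PosSemidef) (x y : m → ℂ) :
    (star x ⬝ᵥ M *ᵥ y).re ^ 2 ≤ (star x ⬝ᵥ M *ᵥ x).re * (star y ⬝ᵥ M *ᵥ y).re := by
  have hsymm : (star y ⬝ᵥ M *ᵥ x).re = (star x ⬝ᵥ M *ᵥ y).re := by
    have h : star (star x ⬝ᵥ M *ᵥ y) = star y ⬝ᵥ M *ᵥ x := by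
      rw [← star_dotProduct_star, star_star, star_mulVec, hM.isHermitian.eq, ← dotProduct_mulVec]
    rw [← h]
    exact Complex.conj_re _
  have hquad (t : ℝ) : 0 ≤ (star y ⬝ᵥ M *ᵥ y).re * (t * t) +
      2 * (star x ⬝ᵥ M *ᵥ y).re * t + (star x ⬝ᵥ M *ᵥ x).re := by
    have h := (Complex.nonneg_iff.mp (hM.dotProduct_mulVec_nonneg (x + (t : ℂ) • y))).1
    simp only [star_add, star_smul, mulVec_add, mulVec_smul, add_dotProduct, dotProduct_add,
      smul_dotProduct, dotProduct_smul, smul_eq_mul, Complex.star_def, Complex.conj_ofReal,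
      Complex.add_re, Complex.re_ofReal_mul, hsymm] at h
    linarith
  have h := discrim_le_zero hquad
  unfold discrim at h
  linarith

/-- If `H` is Hermitian positive definite, `0 ≤ ε < 1`, `⟨v, z⟩ = 1` (standard inner
product), and `‖z - H⁻¹v‖_H ≤ ε ‖H⁻¹v‖_H`, then `1/(1+ε) ≤ ‖v‖²_{H⁻¹} ≤ 1/(1-ε)`. -/
theorem flexible_lanczos_vector_norm_bounds {n : ℕ} (H : Matrix (Fin n) (Fin n) ℂ)
    (hH : H.PosDef) (ε : ℝ) (hε0 : 0 ≤ ε) (hε1 : ε < 1) (v z : Fin n → ℂ)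
    (hvz : star z ⬝ᵥ v = 1)
    (hacc : Real.sqrt ((star (z - H⁻¹ *ᵥ v) ⬝ᵥ H *ᵥ (z - H⁻¹ *ᵥ v)).re) ≤
      ε * Real.sqrt ((star (H⁻¹ *ᵥ v) ⬝ᵥ H *ᵥ (H⁻¹ *ᵥ v)).re)) :
    1 / (1 + ε) ≤ (star v ⬝ᵥ H⁻¹ *ᵥ v).re ∧ (star v ⬝ᵥ H⁻¹ *ᵥ v).re ≤ 1 / (1 - ε) := by
  have hdet : IsUnit H.det := H.isUnit_iff_isUnit_det.mp hH.isUnit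
  have hHu : H *ᵥ (H⁻¹ *ᵥ v) = v := by
    rw [mulVec_mulVec, mul_nonsing_inv _ hdet, one_mulVec]
  have hcs := hH.posSemidef.sq_re_star_dotProduct_mulVec_le (z - H⁻¹ *ᵥ v) (H⁻¹ *ᵥ v)
  have hA0 := (Complex.nonneg_iff.mp (hH.posSemidef.dotProduct_mulVec_nonneg (H⁻¹ *ᵥ v))).1
  have hsq := Real.sqrt_le_iff.mp hacc
  rw [mul_pow, Real.sq_sqrt hA0] at hsq
  have hA : (star (H⁻¹ *ᵥ v) ⬝ᵥ H *ᵥ (H⁻¹ *ᵥ v)).re = (star v ⬝ᵥ H⁻¹ *ᵥ v).re := by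
    rw [hHu, star_mulVec, hH.isHermitian.inv.eq, ← dotProduct_mulVec]
  have hc : (star (z - H⁻¹ *ᵥ v) ⬝ᵥ H *ᵥ (H⁻¹ *ᵥ v)).re =
      1 - (star v ⬝ᵥ H⁻¹ *ᵥ v).re := by
    rw [star_sub, sub_dotProduct, Complex.sub_re, hA, hHu, hvz, Complex.one_re]
  rw [hc, hA] at hcs
  rw [hA] at hsq hA0
  have habs := abs_le_of_sq_le_sq' (a := 1 - (star v ⬝ᵥ H⁻¹ *ᵥ v).re)
    (by nlinarith [mul_le_mul_of_nonneg_right hsq.2 hA0]) (mul_nonneg hε0 hA0)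
  constructor
  · rw [div_le_iff₀ (by linarith)]
    linarith
  · rw [le_div_iff₀ (by linarith)]
    linarith
end
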